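/- Let T_N : H̊^1(R^3) → H^1(H^3) be defined by (T_N φ)(x) = N^{1/2} φ̃(N Ψ_I^{-1}(x)), where φ̃(y) = η(y/N^{1/2}) (e^{Δ/N} φ)(y), η a fixed smooth cutoff equal to 1 on the unit ball and supported in the ball of radius 2, and Ψ_I the standard chart. Then T_N is a bounded linear operator with ‖T_N φ‖_{H^1(H^3)} ≤ C ‖φ‖_{H̊^1(R^3)}, with C independent of N ≥ 1. -/

import Mathlib

open MeasureTheory Real

noncomputable section

abbrev E3 := EuclideanSpace ℝ (Fin 3)

/-- The Euclidean heat semigroup `e^{tΔ}` on `ℝ³` (Gaussian convolution). -/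
def heatSG (t : ℝ) (φ : E3 → ℂ) (y : E3) : ℂ :=
  ∫ z : E3, (((4 * π * t) ^ (-(3 : ℝ) / 2) * Real.exp (-‖y - z‖ ^ 2 / (4 * t)) : ℝ) : ℂ) * φ z

/-- The operator `T_N`, read in the chart `Ψ_I`:
`(T_N φ)(Ψ_I v) = N^{1/2} φ̃(N v)` with `φ̃(y) = η(y/N^{1/2}) (e^{Δ/N}φ)(y)`. -/
def TNop (η : E3 → ℝ) (N : ℝ) (φ : E3 → ℂ) (v : E3) : ℂ :=
  ((N ^ ((1 : ℝ) / 2) : ℝ) : ℂ) * ((η ((N ^ ((1 : ℝ) / 2)) • v) : ℝ) : ℂ) *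
    heatSG N⁻¹ φ (N • v)

lemma hasFDerivAt_translate (φ : E3 → ℂ) (hφ : ContDiff ℝ 1 φ) (x z : E3) :
    HasFDerivAt (fun y => φ (y - z)) (fderiv ℝ φ (x - z)) x := by
  have h := ((hφ.differentiable one_ne_zero) (x - z)).hasFDerivAt
  have h2 : HasFDerivAt (fun y : E3 => y - z) (ContinuousLinearMap.id ℝ E3) x :=
    (hasFDerivAt_id x).sub_const z
  have h3 := h.comp x h2
  rw [ContinuousLinearMap.comp_id] at h3
  exact h3

lemma heat_prob (t : ℝ) (ht : 0 < t) : ∃ ν : Measure E3, IsProbabilityMeasure ν ∧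
    ∀ (φ : E3 → ℂ) (y : E3), heatSG t φ y = ∫ z, φ (y - z) ∂ν := by
  set K : E3 → ℝ := fun z => (4 * π * t) ^ (-(3 : ℝ) / 2) * Real.exp (-‖z‖ ^ 2 / (4 * t)) with hK
  have hKpos : ∀ z, 0 ≤ K z := fun z => by positivity
  have hKc : Continuous K := by fun_prop
  have hI : ∫ z, K z = 1 := by
    have h := GaussianFourier.integral_rexp_neg_mul_sq_norm (V := E3) (b := 1 / (4 * t))
      (by positivity)
    have h2 : ∀ z : E3, K z = (4 * π * t) ^ (-(3 : ℝ) / 2) * Real.exp (-(1 / (4 * t)) * ‖z‖ ^ 2) := by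
      intro z
      simp only [hK]
      congr 2
      ring
    simp_rw [h2]
    rw [integral_const_mul, h]
    have h3 : π / (1 / (4 * t)) = 4 * π * t := by field_simp
    rw [h3, ← Real.rpow_add (by positivity)]
    simp
    norm_num
  have hint : Integrable K := by
    by_contra hc
    rw [integral_undef hc] at hI
    exact zero_ne_one hI
  refine ⟨volume.withDensity (fun z => ENNReal.ofReal (K z)), ⟨?_⟩, ?_⟩
  · rw [withDensity_apply _ MeasurableSet.univ, Measure.restrict_univ,
      ← ofReal_integral_eq_lintegral_ofReal hint (Filter.Eventually.of_forall hKpos), hI]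
    simp
  · intro φ y
    rw [integral_withDensity_eq_integral_toReal_smul (by fun_prop) (by simp)]
    unfold heatSG
    rw [← integral_sub_left_eq_self _ _ y]
    refine integral_congr_ae (Filter.Eventually.of_forall fun z => ?_)
    simp only [sub_sub_cancel, ENNReal.toReal_ofReal (hKpos z)]
    simp only [hK]
    rw [Complex.real_smul]

lemma conv_hasFDerivAt (ν : Measure E3) [IsProbabilityMeasure ν] (φ : E3 → ℂ)
    (hφ : ContDiff ℝ 1 φ) (hc : HasCompactSupport φ) (y : E3) :
    HasFDerivAt (fun y => ∫ z, φ (y - z) ∂ν) (∫ z, fderiv ℝ φ (y - z) ∂ν) y := by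
  have hd : Continuous (fderiv ℝ φ) := hφ.continuous_fderiv one_ne_zero
  obtain ⟨C, hC⟩ := hd.bounded_above_of_compact_support (hc.fderiv ℝ)
  obtain ⟨C', hC'⟩ := hφ.continuous.bounded_above_of_compact_support hc
  have hφc := hφ.continuous
  refine hasFDerivAt_integral_of_dominated_of_fderiv_le (s := Set.univ)
    (F := fun y z => φ (y - z)) (F' := fun y z => fderiv ℝ φ (y - z)) (bound := fun _ => C)
    Filter.univ_mem ?_ ?_ ?_ ?_ (integrable_const _) ?_
  · exact Filter.Eventually.of_forall fun x =>
      (by fun_prop : Continuous fun z => φ (x - z)).aestronglyMeasurable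
  · exact Integrable.of_bound
      (by fun_prop : Continuous fun z => φ (y - z)).aestronglyMeasurable C'
      (Filter.Eventually.of_forall fun z => hC' _)
  · exact (by fun_prop : Continuous fun z => fderiv ℝ φ (y - z)).aestronglyMeasurable
  · exact Filter.Eventually.of_forall fun z x _ => hC _
  · refine Filter.Eventually.of_forall fun z x _ => ?_
    exact hasFDerivAt_translate φ hφ x z

lemma conv_l2 {F : Type*} [NormedAddCommGroup F] [NormedSpace ℝ F]
    (ν : Measure E3) [IsProbabilityMeasure ν]
    (g : E3 → F) (hg : Continuous g) (B : Set E3) (K : ENNReal)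
    (hK : ∀ z, ∫⁻ y in B, ‖g (y - z)‖ₑ ^ 2 ≤ K) :
    ∫⁻ y in B, ‖∫ z, g (y - z) ∂ν‖ₑ ^ 2 ≤ K := by
  have h1 : ∀ y, ‖∫ z, g (y - z) ∂ν‖ₑ ^ 2 ≤ ∫⁻ z, ‖g (y - z)‖ₑ ^ 2 ∂ν := by
    intro y
    have hgy : AEStronglyMeasurable (fun z => ‖g (y - z)‖) ν :=
      (by fun_prop : Continuous fun z => ‖g (y - z)‖).aestronglyMeasurable
    have ha := eLpNorm_le_eLpNorm_of_exponent_le (p := 1) (q := 2) (by norm_num) hgy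
    have hb := eLpNorm_nnreal_pow_eq_lintegral (μ := ν) (f := fun z => ‖g (y - z)‖) (p := 2)
      (by norm_num)
    simp only [NNReal.coe_ofNat, ENNReal.rpow_ofNat, enorm_norm, ENNReal.coe_ofNat] at hb
    rw [← hb]
    gcongr
    refine le_trans ?_ ha
    rw [eLpNorm_one_eq_lintegral_enorm]
    simp only [enorm_norm]
    exact enorm_integral_le_lintegral_enorm _
  calc _ ≤ ∫⁻ y in B, ∫⁻ z, ‖g (y - z)‖ₑ ^ 2 ∂ν := lintegral_mono h1
    _ = ∫⁻ z, (∫⁻ y in B, ‖g (y - z)‖ₑ ^ 2) ∂ν := by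
      refine lintegral_lintegral_swap ?_
      have : Continuous (Function.uncurry fun (y z : E3) => ‖g (y - z)‖ₑ ^ 2) := by
        unfold Function.uncurry
        fun_prop
      exact this.measurable.aemeasurable
    _ ≤ ∫⁻ z, K ∂ν := lintegral_mono hK
    _ = K := by simp

lemma sobolev_ball : ∃ S : NNReal, ∀ N : ℝ, 1 ≤ N → ∀ φ : E3 → ℂ, ContDiff ℝ 1 φ →
    HasCompactSupport φ → ∀ z, ∫⁻ y in Metric.closedBall 0 (2 * √N), ‖φ (y - z)‖ₑ ^ 2 ≤
      S * ENNReal.ofReal N * ∫⁻ x, ‖fderiv ℝ φ x‖ₑ ^ 2 := by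
  set S₀ := SNormLESNormFDerivOfEqConst ℂ (volume : Measure E3) (2 : NNReal) with hS₀
  set V : ENNReal := volume (Metric.ball (0 : E3) 1) with hV
  have hVt : V ≠ ⊤ := measure_ball_lt_top.ne
  refine ⟨S₀ ^ 2 * (4 * (V ^ (2 / 3 : ℝ)).toNNReal), ?_⟩
  intro N hN φ hφ hc z
  have hN0 : 0 < N := by linarith
  set ψ : E3 → ℂ := fun y => φ (y - z) with hψ
  have hψc : ContDiff ℝ 1 ψ := by fun_prop
  have hψs : HasCompactSupport ψ := hc.comp_homeomorph (Homeomorph.subRight z)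
  have h1 := eLpNorm_le_eLpNorm_fderiv_of_eq volume hψc hψs (p := 2) (p' := 6) (by norm_num)
    (by simp) (by simp; norm_num)
  have h2 := eLpNorm_le_eLpNorm_mul_rpow_measure_univ (p := 2) (q := 6) (f := ψ)
    (μ := volume.restrict (Metric.closedBall 0 (2 * √N))) (by norm_num)
    hψc.continuous.aestronglyMeasurable
  have h3 : eLpNorm ψ 6 (volume.restrict (Metric.closedBall 0 (2 * √N))) ≤ eLpNorm ψ 6 volume :=
    eLpNorm_mono_measure _ Measure.restrict_le_self
  have hb := eLpNorm_nnreal_pow_eq_lintegral (f := ψ) (p := 2)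
    (μ := volume.restrict (Metric.closedBall 0 (2 * √N))) (by norm_num)
  have hb' := eLpNorm_nnreal_pow_eq_lintegral (f := fderiv ℝ ψ) (p := 2)
    (μ := (volume : Measure E3)) (by norm_num)
  simp only [NNReal.coe_ofNat, ENNReal.rpow_ofNat, ENNReal.coe_ofNat] at hb hb' h1
  have hd : ∀ x, fderiv ℝ ψ x = fderiv ℝ φ (x - z) := fun x =>
    (hasFDerivAt_translate φ hφ x z).fderiv
  have hD : ∫⁻ x, ‖fderiv ℝ ψ x‖ₑ ^ 2 = ∫⁻ x, ‖fderiv ℝ φ x‖ₑ ^ 2 := by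
    simp_rw [hd]
    exact lintegral_sub_right_eq_self (fun x => ‖fderiv ℝ φ x‖ₑ ^ 2) z
  rw [← hb, ← hD, ← hb']
  have hvol : ((volume.restrict (Metric.closedBall (0 : E3) (2 * √N))) Set.univ
      ^ (1 / (2 : ENNReal).toReal - 1 / (6 : ENNReal).toReal)) ^ 2
      = 4 * V ^ (2 / 3 : ℝ) * ENNReal.ofReal N := by
    rw [Measure.restrict_apply_univ, Measure.addHaar_closedBall _ _ (by positivity),
      ← ENNReal.rpow_natCast, ← ENNReal.rpow_mul]
    have : (1 / (2 : ENNReal).toReal - 1 / (6 : ENNReal).toReal) * ((2 : ℕ) : ℝ) = 2 / 3 := by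
      simp; norm_num
    rw [this, ENNReal.mul_rpow_of_nonneg _ _ (by norm_num), ← hV,
      ENNReal.ofReal_rpow_of_nonneg (by positivity) (by norm_num)]
    have h4 : ((2 * √N) ^ Module.finrank ℝ E3) ^ (2 / 3 : ℝ) = 4 * N := by
      rw [← Real.rpow_natCast, ← Real.rpow_mul (by positivity)]
      have : ((Module.finrank ℝ E3 : ℕ) : ℝ) * (2 / 3) = (2 : ℕ) := by simp; norm_num
      rw [this, Real.rpow_natCast, mul_pow, Real.sq_sqrt hN0.le]
      norm_num
    rw [h4, ENNReal.ofReal_mul (by norm_num)]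
    simp
    ring
  calc _ ≤ (eLpNorm ψ 6 volume * _) ^ 2 := by
        gcongr
        exact h2.trans (by gcongr)
    _ = eLpNorm ψ 6 volume ^ 2 * (4 * V ^ (2 / 3 : ℝ) * ENNReal.ofReal N) := by
        rw [mul_pow, hvol]
    _ ≤ (S₀ * eLpNorm (fderiv ℝ ψ) 2 volume) ^ 2 * (4 * V ^ (2 / 3 : ℝ) * ENNReal.ofReal N) := by
        gcongr
        exact h1
    _ = _ := by
        push_cast
        rw [ENNReal.coe_toNNReal (ENNReal.rpow_ne_top_of_nonneg (by norm_num) hVt)]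
        ring

lemma opnorm_sq_le (L : E3 →L[ℝ] ℂ) :
    ‖L‖ ^ 2 ≤ ∑ i : Fin 3, ‖L (EuclideanSpace.single i 1)‖ ^ 2 := by
  have h : ‖L‖ ≤ √(∑ i : Fin 3, ‖L (EuclideanSpace.single i 1)‖ ^ 2) := by
    refine L.opNorm_le_bound (by positivity) fun v => ?_
    have hv : v = ∑ i, v i • EuclideanSpace.single i (1 : ℝ) := by
      ext j
      simp [Finset.sum_apply, Pi.single_apply]
    have h1 : ‖L v‖ ≤ ∑ i, ‖L (EuclideanSpace.single i 1)‖ * ‖v i‖ := by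
      conv_lhs => rw [hv]
      rw [map_sum]
      refine (norm_sum_le _ _).trans (Finset.sum_le_sum fun i _ => ?_)
      rw [map_smul, norm_smul, mul_comm]
    refine h1.trans ?_
    rw [EuclideanSpace.norm_eq v]
    exact Real.sum_mul_le_sqrt_mul_sqrt _ _ _
  calc ‖L‖ ^ 2 ≤ _ := by gcongr
    _ = _ := Real.sq_sqrt (by positivity)

lemma energy_bound (L : E3 →L[ℝ] ℂ) (u : ℂ) (v : E3) (h : 2 < ‖v‖ → L = 0) :
    ‖((∑ i : Fin 3, ∑ j : Fin 3, ((if i = j then (1 : ℝ) else 0) + v i * v j) *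
        ((L (EuclideanSpace.single i 1)) * (starRingEnd ℂ) (L (EuclideanSpace.single j 1))).re)
      + ‖u‖ ^ 2) * (1 + ‖v‖ ^ 2) ^ (-(1 : ℝ) / 2)‖ ≤ 45 * ‖L‖ ^ 2 + ‖u‖ ^ 2 := by
  have hw : (1 + ‖v‖ ^ 2) ^ (-(1 : ℝ) / 2) ≤ 1 :=
    Real.rpow_le_one_of_one_le_of_nonpos (by nlinarith [sq_nonneg ‖v‖]) (by norm_num)
  have hw0 : 0 ≤ (1 + ‖v‖ ^ 2) ^ (-(1 : ℝ) / 2) := by positivity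
  rw [norm_mul, Real.norm_of_nonneg hw0]
  refine (mul_le_of_le_one_right (norm_nonneg _) hw).trans ?_
  refine (norm_add_le _ _).trans ?_
  have h2 : ‖‖u‖ ^ 2‖ = ‖u‖ ^ 2 := Real.norm_of_nonneg (by positivity)
  rw [h2]
  gcongr
  rcases le_or_gt ‖v‖ 2 with hv | hv
  · have hL : ∀ i, ‖L (EuclideanSpace.single i 1)‖ ≤ ‖L‖ := fun i => by
      simpa using L.le_opNorm (EuclideanSpace.single i 1)
    have ht : ∀ i j : Fin 3, ‖((if i = j then (1 : ℝ) else 0) + v i * v j) *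
        ((L (EuclideanSpace.single i 1)) * (starRingEnd ℂ) (L (EuclideanSpace.single j 1))).re‖
        ≤ 5 * ‖L‖ ^ 2 := by
      intro i j
      rw [norm_mul]
      have ha : ‖(if i = j then (1 : ℝ) else 0) + v i * v j‖ ≤ 5 := by
        refine (norm_add_le _ _).trans ?_
        have h1 : ‖(if i = j then (1 : ℝ) else 0)‖ ≤ 1 := by split_ifs <;> simp
        have h2 : ‖v i * v j‖ ≤ 2 * 2 := by
          rw [norm_mul]
          gcongr
          · exact (PiLp.norm_apply_le v i).trans hv
          · exact (PiLp.norm_apply_le v j).trans hv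
        linarith
      have hb : ‖((L (EuclideanSpace.single i 1)) *
          (starRingEnd ℂ) (L (EuclideanSpace.single j 1))).re‖ ≤ ‖L‖ ^ 2 := by
        refine (Complex.abs_re_le_norm _).trans ?_
        rw [norm_mul, RCLike.norm_conj, sq]
        gcongr <;> apply hL
      gcongr
    refine (norm_sum_le _ _).trans ?_
    calc _ ≤ ∑ i : Fin 3, ∑ j : Fin 3, 5 * ‖L‖ ^ 2 :=
          Finset.sum_le_sum fun i _ => (norm_sum_le _ _).trans (Finset.sum_le_sum fun j _ => ht i j)
      _ = _ := by simp; ring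
  · simp [h hv]

lemma lintegral_dilate (N : ℝ) (hN : 0 < N) (H : E3 → ENNReal) :
    ∫⁻ v, H (N • v) = ENNReal.ofReal ((N ^ 3)⁻¹) * ∫⁻ y, H y := by
  have h := Measure.map_addHaar_smul (volume : Measure E3) hN.ne'
  have he : MeasurableEmbedding (fun x : E3 => N • x) :=
    (Homeomorph.smulOfNeZero N hN.ne' : E3 ≃ₜ E3).measurableEmbedding
  rw [← he.lintegral_map, h, lintegral_smul_measure, abs_of_pos (by positivity)]
  simp

/-- Pointwise bound for a dilated and truncated function. -/
lemma tn_deriv (η : E3 → ℝ) (hη : ContDiff ℝ 1 η) (s M : ℝ) (hs : 0 < s)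
    (hM : ∀ x, ‖η x‖ ≤ M) (hM' : ∀ x, ‖fderiv ℝ η x‖ ≤ M)
    (hη0 : ∀ x, 2 < ‖x‖ → η x = 0) (hη0' : ∀ x, 2 < ‖x‖ → fderiv ℝ η x = 0)
    (f : E3 → ℂ) (f' : E3 → E3 →L[ℝ] ℂ) (hf : ∀ y, HasFDerivAt f (f' y) y)
    (u : E3 → ℂ) (hu : ∀ v, u v = (s : ℂ) * (η (s • v) : ℂ) * f (s ^ 2 • v)) (v : E3) :
    (2 < s * ‖v‖ → fderiv ℝ u v = 0 ∧ u v = 0) ∧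
    ‖u v‖ ≤ s * M * ‖f (s ^ 2 • v)‖ ∧
    ‖fderiv ℝ u v‖ ≤ s ^ 3 * M * ‖f' (s ^ 2 • v)‖ + s ^ 2 * M * ‖f (s ^ 2 • v)‖ := by
  have hM0 : 0 ≤ M := (norm_nonneg _).trans (hM 0)
  have hu' : u = fun v => (s * η (s • v)) • f (s ^ 2 • v) := by
    ext v
    rw [hu, Complex.real_smul]
    push_cast
    rfl
  have hs1 : HasFDerivAt (fun v : E3 => s • v) (s • ContinuousLinearMap.id ℝ E3) v :=
    (hasFDerivAt_id v).const_smul s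
  have hs2 : HasFDerivAt (fun v : E3 => s ^ 2 • v) (s ^ 2 • ContinuousLinearMap.id ℝ E3) v :=
    (hasFDerivAt_id v).const_smul (s ^ 2)
  have h1 := (((hη.differentiable one_ne_zero (s • v)).hasFDerivAt.comp v hs1).const_mul s)
  have h2 := (hf (s ^ 2 • v)).comp v hs2
  have h3 := h1.smul h2
  have hd' : fderiv ℝ u v =
      (s * η (s • v)) • (f' (s ^ 2 • v)).comp (s ^ 2 • ContinuousLinearMap.id ℝ E3) +
      (s • (fderiv ℝ η (s • v)).comp (s • ContinuousLinearMap.id ℝ E3)).smulRight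
        (f (s ^ 2 • v)) := by
    rw [hu']
    exact h3.fderiv
  have hnv : ‖s • v‖ = s * ‖v‖ := by rw [norm_smul, Real.norm_of_nonneg hs.le]
  refine ⟨fun hv => ⟨?_, ?_⟩, ?_, ?_⟩
  · rw [hd']
    ext w
    simp [hη0 (s • v) (by rwa [hnv]), hη0' (s • v) (by rwa [hnv])]
  · rw [hu, hη0 (s • v) (by rwa [hnv])]
    simp
  · rw [hu]
    simp only [norm_mul, Complex.norm_real, Real.norm_of_nonneg hs.le]
    gcongr
    exact hM _
  · rw [hd']
    refine (norm_add_le _ _).trans (add_le_add ?_ ?_)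
    · refine ContinuousLinearMap.opNorm_le_bound _ (by positivity) fun w => ?_
      simp only [ContinuousLinearMap.smul_apply, ContinuousLinearMap.comp_apply,
        Function.comp_apply, ContinuousLinearMap.id_apply, map_smul, norm_smul, norm_mul, norm_pow,
        Real.norm_of_nonneg hs.le]
      have := (f' (s ^ 2 • v)).le_opNorm w
      calc s * ‖η (s • v)‖ * (s ^ 2 * ‖f' (s ^ 2 • v) w‖)
          ≤ s * M * (s ^ 2 * (‖f' (s ^ 2 • v)‖ * ‖w‖)) := by
            gcongr
            exact hM _
        _ = _ := by ring
    · refine ContinuousLinearMap.opNorm_le_bound _ (by positivity) fun w => ?_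
      simp only [ContinuousLinearMap.smulRight_apply, ContinuousLinearMap.smul_apply,
        ContinuousLinearMap.comp_apply,
        Function.comp_apply, ContinuousLinearMap.id_apply, map_smul, norm_smul, norm_mul, norm_pow,
        Real.norm_of_nonneg hs.le]
      have := ((fderiv ℝ η (s • v)).le_opNorm w).trans
        (mul_le_mul_of_nonneg_right (hM' _) (norm_nonneg _))
      calc s * (s * ‖fderiv ℝ η (s • v) w‖) * ‖f (s ^ 2 • v)‖
          ≤ s * (s * (M * ‖w‖)) * ‖f (s ^ 2 • v)‖ := by gcongr
        _ = _ := by ring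

/-- `T_N : Ḣ¹(ℝ³) → H¹(H³)` is bounded uniformly in `N ≥ 1`:
`‖T_N φ‖_{H¹(H³)} ≤ C ‖φ‖_{Ḣ¹(ℝ³)}`.  The `H¹(H³)` norm is written in the chart
(measure `(1+|v|²)^{-1/2} dv`, `|∇_g u|² = Σ_{ij} (δ_{ij}+v_iv_j) Re(∂_i u ∂_j ū)`),
and `φ` ranges over smooth compactly supported functions (a dense class in `Ḣ¹`). -/
theorem stmt11 (η : E3 → ℝ) (hη : ContDiff ℝ (⊤ : ℕ∞) η)
    (hη_supp : Function.support η ⊆ Metric.closedBall 0 2)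
    (hη_one : ∀ x ∈ Metric.ball (0 : E3) 1, η x = 1) :
    ∃ C : ℝ, ∀ N : ℝ, 1 ≤ N → ∀ φ : E3 → ℂ, ContDiff ℝ (⊤ : ℕ∞) φ → HasCompactSupport φ →
      Real.sqrt (∫ v : E3,
          ((∑ i : Fin 3, ∑ j : Fin 3,
              ((if i = j then (1 : ℝ) else 0) + v i * v j) *
                ((fderiv ℝ (TNop η N φ) v (EuclideanSpace.single i 1)) *
                  (starRingEnd ℂ)
                    (fderiv ℝ (TNop η N φ) v (EuclideanSpace.single j 1))).re)
            + ‖TNop η N φ v‖ ^ 2) * (1 + ‖v‖ ^ 2) ^ (-(1 : ℝ) / 2))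
        ≤ C * Real.sqrt (∫ x : E3,
            ∑ i : Fin 3, ‖fderiv ℝ φ x (EuclideanSpace.single i 1)‖ ^ 2) := by
  have hηc : HasCompactSupport η :=
    HasCompactSupport.of_support_subset_isCompact (isCompact_closedBall 0 2) hη_supp
  have hη1 : ContDiff ℝ 1 η := hη.of_le (by exact_mod_cast le_top)
  have hts : tsupport η ⊆ Metric.closedBall 0 2 :=
    closure_minimal hη_supp Metric.isClosed_closedBall
  have hη0 : ∀ x, 2 < ‖x‖ → η x = 0 := by
    intro x hx
    by_contra h
    have := hη_supp h
    simp at this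
    linarith
  have hη0' : ∀ x, 2 < ‖x‖ → fderiv ℝ η x = 0 := by
    intro x hx
    by_contra h
    have := hts (support_fderiv_subset ℝ h)
    simp at this
    linarith
  obtain ⟨M₁, hM₁⟩ := hη1.continuous.bounded_above_of_compact_support hηc
  obtain ⟨M₂, hM₂⟩ := (hη1.continuous_fderiv one_ne_zero).bounded_above_of_compact_support
    (hηc.fderiv ℝ)
  set M := max M₁ M₂ with hMdef
  have hM : ∀ x, ‖η x‖ ≤ M := fun x => (hM₁ x).trans (le_max_left _ _)
  have hM' : ∀ x, ‖fderiv ℝ η x‖ ≤ M := fun x => (hM₂ x).trans (le_max_right _ _)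
  have hM0 : 0 ≤ M := (norm_nonneg _).trans (hM 0)
  obtain ⟨S, hS⟩ := sobolev_ball
  refine ⟨√(91 * M ^ 2 * S + 90 * M ^ 2), ?_⟩
  intro N hN φ hφ hφc
  have hN0 : 0 < N := by linarith
  have hφ1 : ContDiff ℝ 1 φ := hφ.of_le (by exact_mod_cast le_top)
  have hdc : Continuous (fderiv ℝ φ) := hφ1.continuous_fderiv one_ne_zero
  obtain ⟨ν, hν, hheat⟩ := heat_prob N⁻¹ (by positivity)
  set f : E3 → ℂ := fun y => ∫ z, φ (y - z) ∂ν with hf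
  set f' : E3 → E3 →L[ℝ] ℂ := fun y => ∫ z, fderiv ℝ φ (y - z) ∂ν with hf'
  have hff : ∀ y, HasFDerivAt f (f' y) y := conv_hasFDerivAt ν φ hφ1 hφc
  have hfcont : Continuous f := continuous_iff_continuousAt.2 fun y => (hff y).continuousAt
  set B : Set E3 := Metric.closedBall 0 (2 * √N) with hB
  have hBm : MeasurableSet B := Metric.isClosed_closedBall.measurableSet
  set D : ENNReal := ∫⁻ x, ‖fderiv ℝ φ x‖ₑ ^ 2 with hD
  have hA : ∫⁻ y in B, ‖f y‖ₑ ^ 2 ≤ S * ENNReal.ofReal N * D :=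
    conv_l2 ν φ hφ1.continuous B _ (hS N hN φ hφ1 hφc)
  have hA' : ∫⁻ y, ‖f' y‖ₑ ^ 2 ≤ D := by
    have := conv_l2 ν (fderiv ℝ φ) hdc Set.univ D (fun z => by
      rw [Measure.restrict_univ]
      exact (lintegral_sub_right_eq_self (fun x => ‖fderiv ℝ φ x‖ₑ ^ 2) z).le)
    rwa [Measure.restrict_univ] at this
  set s : ℝ := √N with hs
  have hs0 : 0 < s := Real.sqrt_pos.2 hN0
  have hs2 : s ^ 2 = N := Real.sq_sqrt hN0.le
  have hs1 : 1 ≤ s := by rw [hs]; exact Real.one_le_sqrt.2 hN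
  have hu : ∀ v, TNop η N φ v = (s : ℂ) * (η (s • v) : ℂ) * f (s ^ 2 • v) := by
    intro v
    unfold TNop
    rw [← Real.sqrt_eq_rpow, hheat, hs2]
  have key := tn_deriv η hη1 s M hs0 hM hM' hη0 hη0' f f' hff _ hu
  set H : E3 → ENNReal := fun y => ENNReal.ofReal (91 * N ^ 2 * M ^ 2) *
      B.indicator (fun y => ‖f y‖ₑ ^ 2) y + ENNReal.ofReal (90 * N ^ 3 * M ^ 2) * ‖f' y‖ₑ ^ 2 with hH
  have hsq : ∀ {X : Type} [NormedAddCommGroup X] (x : X), ‖x‖ₑ ^ 2 = ENNReal.ofReal (‖x‖ ^ 2) := by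
    intro X _ x
    rw [ENNReal.ofReal_pow (norm_nonneg _), ofReal_norm]
  have hpt : ∀ v, ENNReal.ofReal ‖((∑ i : Fin 3, ∑ j : Fin 3,
              ((if i = j then (1 : ℝ) else 0) + v i * v j) *
                ((fderiv ℝ (TNop η N φ) v (EuclideanSpace.single i 1)) *
                  (starRingEnd ℂ)
                    (fderiv ℝ (TNop η N φ) v (EuclideanSpace.single j 1))).re)
            + ‖TNop η N φ v‖ ^ 2) * (1 + ‖v‖ ^ 2) ^ (-(1 : ℝ) / 2)‖ ≤ H (N • v) := by
    intro v
    obtain ⟨k1, k2, k3⟩ := key v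
    have he := energy_bound (fderiv ℝ (TNop η N φ) v) (TNop η N φ v) v
      (fun hv => (k1 (by nlinarith)).1)
    refine (ENNReal.ofReal_le_ofReal he).trans ?_
    rw [hs2] at k2 k3
    by_cases hv : 2 < s * ‖v‖
    · rw [(k1 hv).1, (k1 hv).2]
      simp
    · have hmem : N • v ∈ B := by
        rw [hB, mem_closedBall_zero_iff, norm_smul, Real.norm_of_nonneg hN0.le, ← hs2]
        nlinarith
      simp only [hH, Set.indicator_of_mem hmem, hsq]
      rw [← ENNReal.ofReal_mul (by positivity), ← ENNReal.ofReal_mul (by positivity),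
        ← ENNReal.ofReal_add (by positivity) (by positivity)]
      refine ENNReal.ofReal_le_ofReal ?_
      set a := ‖f (N • v)‖
      set b := ‖f' (N • v)‖
      have e1 : ‖TNop η N φ v‖ ^ 2 ≤ N * M ^ 2 * a ^ 2 := by
        calc _ ≤ (s * M * a) ^ 2 := by gcongr
          _ = s ^ 2 * M ^ 2 * a ^ 2 := by ring
          _ = _ := by rw [hs2]
      have e2 : ‖fderiv ℝ (TNop η N φ) v‖ ^ 2 ≤ 2 * (N ^ 3 * M ^ 2 * b ^ 2) +
          2 * (N ^ 2 * M ^ 2 * a ^ 2) := by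
        calc _ ≤ (s ^ 3 * M * b + N * M * a) ^ 2 := by gcongr
          _ ≤ 2 * (s ^ 3 * M * b) ^ 2 + 2 * (N * M * a) ^ 2 := by
            nlinarith [sq_nonneg (s ^ 3 * M * b - N * M * a)]
          _ = 2 * ((s ^ 2) ^ 3 * M ^ 2 * b ^ 2) + 2 * (N ^ 2 * M ^ 2 * a ^ 2) := by ring
          _ = _ := by rw [hs2]
      have e3 : N * M ^ 2 * a ^ 2 ≤ N ^ 2 * M ^ 2 * a ^ 2 := by
        gcongr
        nlinarith
      linarith
  have hHint : ∫⁻ v, H (N • v) ≤ ENNReal.ofReal (91 * M ^ 2 * S + 90 * M ^ 2) * D := by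
    rw [lintegral_dilate N hN0 H]
    have h1 : ∫⁻ y, H y ≤ ENNReal.ofReal (91 * N ^ 2 * M ^ 2) * (S * ENNReal.ofReal N * D) +
        ENNReal.ofReal (90 * N ^ 3 * M ^ 2) * D := by
      simp only [hH]
      rw [lintegral_add_left ((((by fun_prop : Continuous fun y => ‖f y‖ₑ ^ 2).measurable).indicator
        hBm).const_mul _), lintegral_const_mul' _ _ ENNReal.ofReal_ne_top,
        lintegral_const_mul' _ _ ENNReal.ofReal_ne_top, lintegral_indicator hBm]
      gcongr
    calc _ ≤ ENNReal.ofReal ((N ^ 3)⁻¹) * (ENNReal.ofReal (91 * N ^ 2 * M ^ 2) *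
          (S * ENNReal.ofReal N * D) + ENNReal.ofReal (90 * N ^ 3 * M ^ 2) * D) := by gcongr
      _ = (ENNReal.ofReal ((N ^ 3)⁻¹) * (ENNReal.ofReal (91 * N ^ 2 * M ^ 2) *
          (ENNReal.ofReal (S : ℝ) * ENNReal.ofReal N) + ENNReal.ofReal (90 * N ^ 3 * M ^ 2))) * D := by
        rw [ENNReal.ofReal_coe_nnreal]
        ring
      _ = _ := by
        congr 1
        rw [← ENNReal.ofReal_mul (by positivity), ← ENNReal.ofReal_mul (by positivity),
          ← ENNReal.ofReal_add (by positivity) (by positivity), ← ENNReal.ofReal_mul (by positivity)]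
        congr 1
        field_simp
  set R : ℝ := ∫ x : E3, ∑ i : Fin 3, ‖fderiv ℝ φ x (EuclideanSpace.single i 1)‖ ^ 2 with hR
  have hR0 : 0 ≤ R := integral_nonneg fun x => by positivity
  have hDR : D ≤ ENNReal.ofReal R := by
    have hcs : HasCompactSupport fun x : E3 =>
        ∑ i : Fin 3, ‖fderiv ℝ φ x (EuclideanSpace.single i 1)‖ ^ 2 :=
      (hφc.fderiv ℝ).comp_left
        (g := fun L : E3 →L[ℝ] ℂ => ∑ i : Fin 3, ‖L (EuclideanSpace.single i 1)‖ ^ 2) (by simp)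
    have hint : Integrable fun x : E3 =>
        ∑ i : Fin 3, ‖fderiv ℝ φ x (EuclideanSpace.single i 1)‖ ^ 2 :=
      Continuous.integrable_of_hasCompactSupport (by fun_prop) hcs
    rw [hR, ofReal_integral_eq_lintegral_ofReal hint
      (Filter.Eventually.of_forall fun x => by positivity)]
    refine lintegral_mono fun x => ?_
    rw [hsq]
    exact ENNReal.ofReal_le_ofReal (opnorm_sq_le _)
  rw [← Real.sqrt_mul (by positivity)]
  refine Real.sqrt_le_sqrt ?_
  refine (Real.le_norm_self _).trans ((norm_integral_le_lintegral_norm _).trans ?_)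
  refine ENNReal.toReal_le_of_le_ofReal (by positivity) ?_
  refine (lintegral_mono hpt).trans (hHint.trans ?_)
  rw [ENNReal.ofReal_mul (by positivity)]
  gcongr

end
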